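/- Let E₂⁽²⁾(τ) = 2E₂(2τ) − E₂(τ), and let f : ℍ → ℂ be defined by f(τ) = E₂⁽²⁾(τ)·η(2τ)²⁴/η(τ)²⁸. Then f is holomorphic on ℍ and satisfies the second-order modular linear differential equation D²f − (1/6)·E₂·Df − (5/9)·E₄·f = 0 on ℍ (this is the MLDE of weight 0 with parameter h = 9, since (h−1)(h+1)/144 = 80/144 = 5/9). (In the paper, f is the normalized character of the simple affine vertex algebra V_{−5/2}(F₄).) -/

import Mathlib

noncomputable section

open Complex

/-- `q = exp(2πiτ)`. -/
def qc (τ : ℂ) : ℂ := Complex.exp (2 * (Real.pi : ℂ) * Complex.I * τ)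

/-- `σ_k(n) = ∑_{d ∣ n} d^k`, as a complex number. -/
def sigmaC (k n : ℕ) : ℂ := ∑ d ∈ n.divisors, (d : ℂ) ^ k

/-- Eisenstein series `E₂(τ) = 1 - 24 ∑_{n≥1} σ₁(n) qⁿ`. -/
def E2 (τ : ℂ) : ℂ := 1 - 24 * ∑' n : ℕ, sigmaC 1 (n + 1) * qc τ ^ (n + 1)

/-- Eisenstein series `E₄(τ) = 1 + 240 ∑_{n≥1} σ₃(n) qⁿ`. -/
def E4 (τ : ℂ) : ℂ := 1 + 240 * ∑' n : ℕ, sigmaC 3 (n + 1) * qc τ ^ (n + 1)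

/-- Eisenstein series `E₆(τ) = 1 - 504 ∑_{n≥1} σ₅(n) qⁿ`. -/
def E6 (τ : ℂ) : ℂ := 1 - 504 * ∑' n : ℕ, sigmaC 5 (n + 1) * qc τ ^ (n + 1)

/-- The normalized derivative of `E₄`: `(DE₄)(τ) = 240 ∑_{n≥1} n σ₃(n) qⁿ`. -/
def DE4 (τ : ℂ) : ℂ := 240 * ∑' n : ℕ, ((n : ℂ) + 1) * sigmaC 3 (n + 1) * qc τ ^ (n + 1)

/-- Dedekind eta function `η(τ) = exp(2πiτ/24) ∏_{n≥1} (1 - qⁿ)`. -/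
def dedekindEta (τ : ℂ) : ℂ :=
  Complex.exp (2 * (Real.pi : ℂ) * Complex.I * τ / 24) * ∏' n : ℕ, (1 - qc τ ^ (n + 1))

/-- Normalized derivative `D = (2πi)⁻¹ d/dτ`. -/
def Dop (f : ℂ → ℂ) : ℂ → ℂ := fun τ => (2 * (Real.pi : ℂ) * Complex.I)⁻¹ * deriv f τ

/-- The upper half-plane, as a subset of `ℂ`. -/
def UHP : Set ℂ := {τ : ℂ | 0 < τ.im}

/-- `E₂⁽²⁾(τ) = 2 E₂(2τ) - E₂(τ)`. -/
def E2_2 (τ : ℂ) : ℂ := 2 * E2 (2 * τ) - E2 τ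

/-- The normalized character of `V_{-5/2}(F₄)`: `f(τ) = E₂⁽²⁾(τ) η(2τ)²⁴ / η(τ)²⁸`. -/
def charF4 (τ : ℂ) : ℂ := E2_2 τ * dedekindEta (2 * τ) ^ 24 / dedekindEta τ ^ 28


open scoped MatrixGroups ModularForm Topology Manifold
open Filter

/-- The filter of points of the complex plane whose imaginary part goes to infinity. -/
abbrev Iinf : Filter ℂ := Filter.comap Complex.im Filter.atTop

lemma isOpen_UHP : IsOpen UHP := isOpen_lt continuous_const Complex.continuous_im

lemma sigmaC_eq (k n : ℕ) : sigmaC k n = (ArithmeticFunction.sigma k n : ℂ) := by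
  simp [sigmaC, ArithmeticFunction.sigma_apply]

lemma norm_sigmaC_le (k n : ℕ) : ‖sigmaC k n‖ ≤ (n : ℝ) ^ (k + 1) := by
  rw [sigmaC_eq, Complex.norm_natCast]
  exact_mod_cast ArithmeticFunction.sigma_le_pow_succ k n

lemma norm_qc (τ : ℂ) : ‖qc τ‖ = Real.exp (-(2 * Real.pi * τ.im)) := by
  rw [qc, Complex.norm_exp]
  congr 1
  simp

lemma tendsto_qc : Tendsto qc Iinf (𝓝 0) := by
  rw [tendsto_zero_iff_norm_tendsto_zero]
  simp_rw [norm_qc]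
  refine Real.tendsto_exp_neg_atTop_nhds_zero.comp ?_
  refine Tendsto.const_mul_atTop (by positivity) tendsto_comap

lemma tendsto_series (k : ℕ) :
    Tendsto (fun τ => ∑' n : ℕ, sigmaC k (n + 1) * qc τ ^ (n + 1)) Iinf (𝓝 0) := by
  have hs : Summable (fun n : ℕ => ((n + 1 : ℕ) : ℝ) ^ (k + 1) * (1 / 2 : ℝ) ^ (n + 1)) :=
    (summable_nat_add_iff 1).mpr (summable_pow_mul_geometric_of_norm_lt_one (R := ℝ) (k + 1)
      (r := 1 / 2) (by norm_num))
  have h := tendsto_tsum_of_dominated_convergence (𝓕 := Iinf)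
    (f := fun τ (n : ℕ) => sigmaC k (n + 1) * qc τ ^ (n + 1)) (g := fun _ => 0) hs ?_ ?_
  · simpa using h
  · intro n
    simpa using (tendsto_qc.pow (n + 1)).const_mul (sigmaC k (n + 1))
  · have : ∀ᶠ τ in Iinf, ‖qc τ‖ < 1 / 2 := by
      have := tendsto_qc.norm
      rw [norm_zero] at this
      exact this.eventually (gt_mem_nhds (by norm_num))
    filter_upwards [this] with τ hτ n
    rw [norm_mul, norm_pow]
    have := norm_sigmaC_le k (n + 1)
    gcongr

lemma tendsto_E2 : Tendsto E2 Iinf (𝓝 1) := by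
  have := ((tendsto_series 1).const_mul 24).const_sub 1
  simpa [E2] using! this

lemma tendsto_E4 : Tendsto E4 Iinf (𝓝 1) := by
  have := ((tendsto_series 3).const_mul 240).const_add 1
  simpa [E4] using! this

lemma tendsto_E6 : Tendsto E6 Iinf (𝓝 1) := by
  have := ((tendsto_series 5).const_mul 504).const_sub 1
  simpa [E6] using! this

lemma E2_coe (z : UpperHalfPlane) : E2 z = EisensteinSeries.E2 z := by
  rw [EisensteinSeries.E2_eq_tsum_cexp, tsum_pnat_eq_tsum_succ
    (f := fun n ↦ (ArithmeticFunction.sigma 1 n : ℂ) * cexp (2 * Real.pi * I * z) ^ n)]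
  simp only [E2, sigmaC_eq, qc]

lemma E4_coe (z : UpperHalfPlane) : E4 z = ModularForm.E₄ z := by
  rw [EisensteinSeries.q_expansion_bernoulli (k := 4) _ ⟨2, rfl⟩]
  simp only [zpow_natCast]
  rw [tsum_pnat_eq_tsum_succ
    (f := fun n ↦ (ArithmeticFunction.sigma (4 - 1) n : ℂ) * cexp (2 * Real.pi * I * z) ^ n)]
  simp only [E4, sigmaC_eq, qc]
  norm_num [show bernoulli 4 = -1 / 30 by decide +kernel]

lemma E6_coe (z : UpperHalfPlane) : E6 z = ModularForm.E₆ z := by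
  rw [EisensteinSeries.q_expansion_bernoulli (k := 6) _ ⟨3, rfl⟩]
  simp only [zpow_natCast]
  rw [tsum_pnat_eq_tsum_succ
    (f := fun n ↦ (ArithmeticFunction.sigma (6 - 1) n : ℂ) * cexp (2 * Real.pi * I * z) ^ n)]
  simp only [E6, sigmaC_eq, qc]
  norm_num [show bernoulli 6 = 1 / 42 by decide +kernel]

lemma diffOn_of_coe {F : ℂ → ℂ} {f : UpperHalfPlane → ℂ} (h : ∀ z : UpperHalfPlane, F z = f z)
    (hf : MDiff f) : DifferentiableOn ℂ F UHP := by
  rw [UpperHalfPlane.mdifferentiable_iff] at hf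
  refine hf.congr fun z hz => ?_
  have : (0 : ℝ) < z.im := hz
  simpa [UpperHalfPlane.ofComplex_apply_of_im_pos this] using h ⟨z, this⟩

lemma diff_E2 : DifferentiableOn ℂ E2 UHP :=
  diffOn_of_coe E2_coe E2_mdifferentiable
lemma diff_E4 : DifferentiableOn ℂ E4 UHP := diffOn_of_coe E4_coe ModularForm.E₄.holo'
lemma diff_E6 : DifferentiableOn ℂ E6 UHP := diffOn_of_coe E6_coe ModularForm.E₆.holo'

lemma qc_add_one (τ : ℂ) : qc (τ + 1) = qc τ := by
  rw [qc, qc, mul_add, mul_one, Complex.exp_add, Complex.exp_two_pi_mul_I, mul_one]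

lemma E2_add_one (τ : ℂ) : E2 (τ + 1) = E2 τ := by simp only [E2, qc_add_one]
lemma E4_add_one (τ : ℂ) : E4 (τ + 1) = E4 τ := by simp only [E4, qc_add_one]
lemma E6_add_one (τ : ℂ) : E6 (τ + 1) = E6 τ := by simp only [E6, qc_add_one]

lemma coe_S_smul (z : UpperHalfPlane) : ((ModularGroup.S • z : UpperHalfPlane) : ℂ) = -1 / z := by
  rw [UpperHalfPlane.modular_S_smul]
  simp [neg_div]

lemma slash_S_apply (f : UpperHalfPlane → ℂ) (k : ℕ) (z : UpperHalfPlane) :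
    (f ∣[(k : ℤ)] ModularGroup.S) z = f (ModularGroup.S • z) * ((z : ℂ) ^ k)⁻¹ := by
  rw [ModularForm.SL_slash_apply, ModularGroup.denom_S]
  simp

lemma slash_T_apply (f : UpperHalfPlane → ℂ) (k : ℕ) (z : UpperHalfPlane) :
    (f ∣[(k : ℤ)] ModularGroup.T) z = f (ModularGroup.T • z) := by
  rw [ModularForm.SL_slash_apply]
  simp [ModularGroup.denom_apply, ModularGroup.coe_T]

lemma neg_inv_mem {τ : ℂ} (h : τ ∈ UHP) : -1 / τ ∈ UHP := by
  have := (ModularGroup.S • (⟨τ, h⟩ : UpperHalfPlane)).im_pos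
  have h2 := coe_S_smul ⟨τ, h⟩
  show 0 < (-1 / τ).im
  rw [← UpperHalfPlane.coe_im, h2] at this
  exact this

lemma ne_zero_of_mem {τ : ℂ} (h : τ ∈ UHP) : τ ≠ 0 := by
  rintro rfl
  simp [UHP] at h

lemma E2_S {τ : ℂ} (h : τ ∈ UHP) :
    E2 (-1 / τ) = τ ^ 2 * E2 τ + 12 * τ * (2 * Real.pi * I)⁻¹ := by
  have h0 := ne_zero_of_mem h
  let z : UpperHalfPlane := ⟨τ, h⟩
  have h1 := congrFun (EisensteinSeries.E2_slash_action ModularGroup.S) z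
  have h2 := slash_S_apply EisensteinSeries.E2 2 z
  rw [show ((2 : ℕ) : ℤ) = 2 from rfl, h1, ← E2_coe, coe_S_smul] at h2
  simp only [Pi.sub_apply, Pi.smul_apply, EisensteinSeries.D2_S, riemannZeta_two, ← E2_coe,
    smul_eq_mul] at h2
  have h3 : (z : ℂ) = τ := rfl
  rw [h3] at h2
  have hpi : (Real.pi : ℂ) ≠ 0 := by simp
  field_simp at h2 ⊢
  linear_combination (-2 * I) * h2 - 12 * τ * I_sq

lemma MF_S {k : ℕ} (f : ModularForm 𝒮ℒ k) {F : ℂ → ℂ} (hF : ∀ z : UpperHalfPlane, F z = f z)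
    {τ : ℂ} (h : τ ∈ UHP) : F (-1 / τ) = τ ^ k * F τ := by
  have h0 := ne_zero_of_mem h
  let z : UpperHalfPlane := ⟨τ, h⟩
  have h1 : (⇑f ∣[(k : ℤ)] ModularGroup.S) = f :=
    SlashInvariantForm.slash_action_eqn f _ ⟨ModularGroup.S, rfl⟩
  have h2 := slash_S_apply f k z
  rw [h1, ← hF, ← hF, coe_S_smul] at h2
  have h3 : (z : ℂ) = τ := rfl
  rw [h3] at h2
  rw [h2]
  field_simp

lemma E4_S {τ : ℂ} (h : τ ∈ UHP) : E4 (-1 / τ) = τ ^ 4 * E4 τ := MF_S ModularForm.E₄ E4_coe h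
lemma E6_S {τ : ℂ} (h : τ ∈ UHP) : E6 (-1 / τ) = τ ^ 6 * E6 τ := MF_S ModularForm.E₆ E6_coe h

/-- Cuspidal level one forms of weight less than `12` vanish. -/
lemma key {k : ℕ} (hk : k < 12) {F : ℂ → ℂ} (hF : DifferentiableOn ℂ F UHP)
    (hT : ∀ τ ∈ UHP, F (τ + 1) = F τ) (hS : ∀ τ ∈ UHP, F (-1 / τ) = τ ^ k * F τ)
    (hlim : Tendsto F Iinf (𝓝 0)) {τ : ℂ} (hτ : τ ∈ UHP) : F τ = 0 := by
  let f : UpperHalfPlane → ℂ := fun z => F z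
  have fS : f ∣[(k : ℤ)] ModularGroup.S = f := by
    ext z
    have h0 := ne_zero_of_mem (show (z : ℂ) ∈ UHP from z.2)
    rw [slash_S_apply]
    simp only [f]
    rw [coe_S_smul, hS _ z.2]
    field_simp
  have fT : f ∣[(k : ℤ)] ModularGroup.T = f := by
    ext z
    rw [slash_T_apply]
    simp only [f]
    rw [UpperHalfPlane.modular_T_smul, UpperHalfPlane.coe_vadd]
    have := hT _ z.2
    rw [add_comm] at this
    simpa using this
  have hinv := SlashInvariantForm.slash_action_generators_SL2Z fS fT
  have hdiff : MDiff f := by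
    rw [UpperHalfPlane.mdifferentiable_iff]
    refine hF.congr fun z hz => ?_
    have : (0 : ℝ) < z.im := hz
    simp [f, UpperHalfPlane.ofComplex_apply_of_im_pos this]
  have hzero : UpperHalfPlane.IsZeroAtImInfty f := by
    refine hlim.comp ?_
    exact tendsto_comap_iff.mpr tendsto_comap
  let g : CuspForm 𝒮ℒ k :=
    { toFun := f
      slash_action_eq' := fun _ ⟨γ, hγ⟩ ↦ hγ ▸ hinv γ
      holo' := hdiff
      zero_at_cusps' {c} hc := by
        rw [Subgroup.IsArithmetic.isCusp_iff_isCusp_SL2Z] at hc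
        rw [OnePoint.isZeroAt_iff_forall_SL2Z hc]
        intro γ _
        rw [hinv γ]
        exact hzero }
  have hg : g = 0 := rank_zero_iff_forall_zero.mp
    (CuspForm.rank_eq_zero_of_weight_lt_twelve (by exact_mod_cast hk)) g
  exact congrArg (fun u : CuspForm 𝒮ℒ k => u ⟨τ, hτ⟩) hg

lemma tpi_ne : (2 * (Real.pi : ℂ) * I) ≠ 0 := by simp

lemma diffAt {F : ℂ → ℂ} (hF : DifferentiableOn ℂ F UHP) {τ : ℂ} (h : τ ∈ UHP) :
    DifferentiableAt ℂ F τ := hF.differentiableAt (isOpen_UHP.mem_nhds h)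

lemma diff_Dop {F : ℂ → ℂ} (hF : DifferentiableOn ℂ F UHP) : DifferentiableOn ℂ (Dop F) UHP :=
  (hF.deriv isOpen_UHP).const_mul _

/-- Cauchy estimate: if `F` converges at `i∞` then its derivative tends to zero there. -/
lemma tendsto_Dop {F : ℂ → ℂ} (hF : DifferentiableOn ℂ F UHP) {c : ℂ}
    (hlim : Tendsto F Iinf (𝓝 c)) : Tendsto (Dop F) Iinf (𝓝 0) := by
  have h : Tendsto (deriv F) Iinf (𝓝 0) := by
    rw [Metric.tendsto_nhds] at hlim ⊢
    intro ε hε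
    have h1 := hlim (ε / 2) (by positivity)
    rw [Filter.eventually_comap, Filter.eventually_atTop] at h1
    obtain ⟨M, hM⟩ := h1
    rw [Filter.eventually_comap, Filter.eventually_atTop]
    refine ⟨max M 0 + 2, ?_⟩
    rintro b hb τ rfl
    have him : ∀ w ∈ Metric.closedBall τ 1, max M 0 < w.im := by
      intro w hw
      have h2 : |(w - τ).im| ≤ 1 :=
        (Complex.abs_im_le_norm _).trans (by simpa [dist_eq_norm] using hw)
      rw [Complex.sub_im, abs_le] at h2
      linarith [h2.1]
    have hsub : Metric.closedBall τ 1 ⊆ UHP := fun w hw =>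
      lt_of_le_of_lt (le_max_right M 0) (him w hw)
    have hd : DiffContOnCl ℂ (fun w => F w - c) (Metric.ball τ 1) := by
      refine DifferentiableOn.diffContOnCl ?_
      rw [closure_ball τ one_ne_zero]
      exact (hF.mono hsub).sub_const c
    have h3 := Complex.norm_deriv_le_of_forall_mem_sphere_norm_le (C := ε / 2) one_pos hd ?_
    · rw [deriv_sub_const] at h3
      rw [dist_zero_right]
      linarith
    · intro w hw
      have hw' := him w (Metric.sphere_subset_closedBall hw)
      have := hM w.im ((le_max_left M 0).trans hw'.le) w rfl
      rw [dist_eq_norm] at this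
      exact this.le
  have h' := h.const_mul (2 * (Real.pi : ℂ) * I)⁻¹
  rw [mul_zero] at h'
  exact h'

lemma Dop_add_one {F : ℂ → ℂ} (hT : ∀ τ, F (τ + 1) = F τ) (τ : ℂ) : Dop F (τ + 1) = Dop F τ := by
  have : deriv (fun x => F (x + 1)) τ = deriv F (τ + 1) := deriv_comp_add_const F 1 τ
  simp only [hT] at this
  simp [Dop, ← this]

lemma Dop_S {k : ℕ} {F : ℂ → ℂ} (hF : DifferentiableOn ℂ F UHP)
    (hS : ∀ τ ∈ UHP, F (-1 / τ) = τ ^ (k + 1) * F τ) {τ : ℂ} (h : τ ∈ UHP) :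
    Dop F (-1 / τ) = τ ^ (k + 3) * Dop F τ
      + (k + 1) * τ ^ (k + 2) * F τ * (2 * (Real.pi : ℂ) * I)⁻¹ := by
  have h0 := ne_zero_of_mem h
  have d1 : HasDerivAt (fun x : ℂ => -1 / x) (1 / τ ^ 2) τ := by
    have := (hasDerivAt_inv h0).const_mul (-1)
    simpa [div_eq_mul_inv] using! this
  have d2 := HasDerivAt.comp τ (diffAt hF (neg_inv_mem h)).hasDerivAt d1
  have d3 : HasDerivAt (fun x => x ^ (k + 1) * F x)
      (((k + 1 : ℕ) : ℂ) * τ ^ k * F τ + τ ^ (k + 1) * deriv F τ) τ := by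
    simpa using! (hasDerivAt_pow (k + 1) τ).mul (diffAt hF h).hasDerivAt
  have d4 : (F ∘ fun x => -1 / x) =ᶠ[𝓝 τ] fun x => x ^ (k + 1) * F x := by
    filter_upwards [isOpen_UHP.mem_nhds h] with x hx using hS x hx
  have d5 := (d4.hasDerivAt_iff.mp d2).unique d3
  have hd : deriv F (-1 / τ) =
      τ ^ 2 * (((k + 1 : ℕ) : ℂ) * τ ^ k * F τ + τ ^ (k + 1) * deriv F τ) := by
    rw [← d5]
    field_simp
  simp only [Dop]
  rw [hd]
  push_cast
  ring

lemma ramanujan4 {τ : ℂ} (h : τ ∈ UHP) : Dop E4 τ = (E2 τ * E4 τ - E6 τ) / 3 := by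
  have := key (k := 6) (by norm_num) (F := fun τ => Dop E4 τ - (E2 τ * E4 τ - E6 τ) / 3)
    ((diff_Dop diff_E4).sub (((diff_E2.mul diff_E4).sub diff_E6).div_const 3)) ?_ ?_ ?_ h
  · exact sub_eq_zero.mp this
  · intro τ _
    simp only [Dop_add_one E4_add_one, E2_add_one, E4_add_one, E6_add_one]
  · intro τ h
    simp only [Dop_S (k := 3) diff_E4 (fun τ h => E4_S h) h, E2_S h, E4_S h, E6_S h]
    push_cast
    ring
  · have := (tendsto_Dop diff_E4 tendsto_E4).sub
      (((tendsto_E2.mul tendsto_E4).sub tendsto_E6).div_const 3)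
    simpa using! this

lemma ramanujan6 {τ : ℂ} (h : τ ∈ UHP) : Dop E6 τ = (E2 τ * E6 τ - E4 τ ^ 2) / 2 := by
  have := key (k := 8) (by norm_num) (F := fun τ => Dop E6 τ - (E2 τ * E6 τ - E4 τ ^ 2) / 2)
    ((diff_Dop diff_E6).sub (((diff_E2.mul diff_E6).sub (diff_E4.pow 2)).div_const 2)) ?_ ?_ ?_ h
  · exact sub_eq_zero.mp this
  · intro τ _
    simp only [Dop_add_one E6_add_one, E2_add_one, E4_add_one, E6_add_one]
  · intro τ h
    simp only [Dop_S (k := 5) diff_E6 (fun τ h => E6_S h) h, E2_S h, E4_S h, E6_S h]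
    push_cast
    ring
  · have := (tendsto_Dop diff_E6 tendsto_E6).sub
      (((tendsto_E2.mul tendsto_E6).sub (tendsto_E4.pow 2)).div_const 2)
    simpa using! this

/-- The image of `E2_2` under the slash action of `S`. -/
def Bfun (τ : ℂ) : ℂ := -E2_2 (τ / 2) / 2
/-- The image of `E2_2` under the slash action of `S T`. -/
def Cfun (τ : ℂ) : ℂ := -E2_2 ((τ + 1) / 2) / 2

lemma two_mul_mem {τ : ℂ} (h : τ ∈ UHP) : 2 * τ ∈ UHP := by
  have : 0 < τ.im := h
  simpa [UHP] using this

lemma half_mem {τ : ℂ} (h : τ ∈ UHP) : τ / 2 ∈ UHP := by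
  have : 0 < τ.im := h
  simpa [UHP] using this

lemma add_one_mem {τ : ℂ} (h : τ ∈ UHP) : τ + 1 ∈ UHP := by
  have : 0 < τ.im := h
  simpa [UHP] using this

lemma sub_one_mem {τ : ℂ} (h : τ ∈ UHP) : τ - 1 ∈ UHP := by
  have : 0 < τ.im := h
  simpa [UHP] using this

lemma diff_A : DifferentiableOn ℂ E2_2 UHP := by
  have : DifferentiableOn ℂ (fun τ => E2 (2 * τ)) UHP :=
    diff_E2.comp (by fun_prop) fun τ h => two_mul_mem h
  exact (this.const_mul 2).sub diff_E2

lemma diff_B : DifferentiableOn ℂ Bfun UHP := by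
  have : DifferentiableOn ℂ (fun τ => E2_2 (τ / 2)) UHP :=
    diff_A.comp (by fun_prop) fun τ h => half_mem h
  exact this.neg.div_const 2

lemma diff_C : DifferentiableOn ℂ Cfun UHP := by
  have : DifferentiableOn ℂ (fun τ => E2_2 ((τ + 1) / 2)) UHP :=
    diff_A.comp (by fun_prop) fun τ h => half_mem (add_one_mem h)
  exact this.neg.div_const 2

lemma tendsto_A : Tendsto E2_2 Iinf (𝓝 1) := by
  have h : Tendsto (fun τ : ℂ => 2 * τ) Iinf Iinf := by
    refine tendsto_comap_iff.mpr ?_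
    have : Tendsto (fun τ : ℂ => 2 * τ.im) Iinf atTop :=
      Tendsto.const_mul_atTop (by norm_num) tendsto_comap
    refine this.congr fun τ => by simp
  have := ((tendsto_E2.comp h).const_mul 2).sub tendsto_E2
  norm_num at this
  exact this

lemma tendsto_half : Tendsto (fun τ : ℂ => τ / 2) Iinf Iinf := by
  refine tendsto_comap_iff.mpr ?_
  have : Tendsto (fun τ : ℂ => τ.im / 2) Iinf atTop :=
    Tendsto.atTop_div_const (by norm_num) tendsto_comap
  refine this.congr fun τ => by simp

lemma tendsto_B : Tendsto Bfun Iinf (𝓝 (-1 / 2)) :=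
  ((tendsto_A.comp tendsto_half).neg).div_const 2

lemma tendsto_C : Tendsto Cfun Iinf (𝓝 (-1 / 2)) := by
  have h : Tendsto (fun τ : ℂ => τ + 1) Iinf Iinf := by
    refine tendsto_comap_iff.mpr ?_
    exact Tendsto.congr (f₁ := Complex.im) (fun τ => by simp) tendsto_comap
  exact (((tendsto_A.comp tendsto_half).comp h).neg).div_const 2

lemma A_add_one (τ : ℂ) : E2_2 (τ + 1) = E2_2 τ := by
  rw [E2_2, E2_2, E2_add_one, show 2 * (τ + 1) = 2 * τ + 1 + 1 by ring, E2_add_one, E2_add_one]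

lemma B_add_one (τ : ℂ) : Bfun (τ + 1) = Cfun τ := rfl

lemma C_add_one (τ : ℂ) : Cfun (τ + 1) = Bfun τ := by
  rw [Cfun, Bfun, show (τ + 1 + 1) / 2 = τ / 2 + 1 by ring, A_add_one]

lemma A_S {τ : ℂ} (h : τ ∈ UHP) : E2_2 (-1 / τ) = τ ^ 2 * Bfun τ := by
  have h0 := ne_zero_of_mem h
  rw [E2_2, Bfun, E2_2, show 2 * (-1 / τ) = -1 / (τ / 2) by field_simp, E2_S (half_mem h), E2_S h,
    show 2 * (τ / 2) = τ by ring]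
  ring

lemma B_S {τ : ℂ} (h : τ ∈ UHP) : Bfun (-1 / τ) = τ ^ 2 * E2_2 τ := by
  have h0 := ne_zero_of_mem h
  have := A_S (neg_inv_mem h)
  rw [show -1 / (-1 / τ) = τ by field_simp] at this
  rw [this]
  field_simp

lemma C_S {τ : ℂ} (h : τ ∈ UHP) : Cfun (-1 / τ) = τ ^ 2 * Cfun τ := by
  have h0 := ne_zero_of_mem h
  have h1 := ne_zero_of_mem (sub_one_mem h)
  set v : ℂ := -1 / (τ - 1) - 1 with hv
  have hvm : v ∈ UHP := sub_one_mem (neg_inv_mem (sub_one_mem h))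
  have hvτ : v = -τ / (τ - 1) := by
    rw [hv]
    field_simp
    ring
  have hAv : E2_2 v = (τ - 1) ^ 2 * Cfun τ := by
    have e1 : E2_2 v = E2_2 (-1 / (τ - 1)) := by rw [← A_add_one v, hv, sub_add_cancel]
    rw [e1, A_S (sub_one_mem h)]
    have e2 := C_add_one (τ - 1)
    rw [sub_add_cancel] at e2
    rw [e2]
  have e3 := A_S (two_mul_mem hvm)
  rw [Bfun, mul_div_cancel_left₀ _ (two_ne_zero), hAv] at e3
  have e4 : (-1 / τ + 1) / 2 = -1 / (2 * v) := by
    rw [hvτ]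
    field_simp
    ring
  rw [Cfun, e4, e3, hvτ]
  field_simp

lemma sum_ABC {τ : ℂ} (h : τ ∈ UHP) : E2_2 τ + Bfun τ + Cfun τ = 0 := by
  refine key (k := 2) (by norm_num) (F := fun τ => E2_2 τ + Bfun τ + Cfun τ)
    ((diff_A.add diff_B).add diff_C) ?_ ?_ ?_ h
  · intro τ _
    simp only [A_add_one, B_add_one, C_add_one]
    ring
  · intro τ h
    simp only [A_S h, B_S h, C_S h]
    ring
  · have := (tendsto_A.add tendsto_B).add tendsto_C
    norm_num at this
    exact this

lemma sum2_ABC {τ : ℂ} (h : τ ∈ UHP) :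
    E2_2 τ * Bfun τ + E2_2 τ * Cfun τ + Bfun τ * Cfun τ + 3 / 4 * E4 τ = 0 := by
  refine key (k := 4) (by norm_num)
    (F := fun τ => E2_2 τ * Bfun τ + E2_2 τ * Cfun τ + Bfun τ * Cfun τ + 3 / 4 * E4 τ)
    ((((diff_A.mul diff_B).add (diff_A.mul diff_C)).add (diff_B.mul diff_C)).add
      (diff_E4.const_mul _)) ?_ ?_ ?_ h
  · intro τ _
    simp only [A_add_one, B_add_one, C_add_one, E4_add_one]
    ring
  · intro τ h
    simp only [A_S h, B_S h, C_S h, E4_S h]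
    ring
  · have := (((tendsto_A.mul tendsto_B).add (tendsto_A.mul tendsto_C)).add
      (tendsto_B.mul tendsto_C)).add (tendsto_E4.const_mul (3 / 4))
    norm_num at this
    exact this

lemma prod_ABC {τ : ℂ} (h : τ ∈ UHP) : E2_2 τ * Bfun τ * Cfun τ - E6 τ / 4 = 0 := by
  refine key (k := 6) (by norm_num) (F := fun τ => E2_2 τ * Bfun τ * Cfun τ - E6 τ / 4)
    (((diff_A.mul diff_B).mul diff_C).sub (diff_E6.div_const _)) ?_ ?_ ?_ h
  · intro τ _
    simp only [A_add_one, B_add_one, C_add_one, E6_add_one]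
    ring
  · intro τ h
    simp only [A_S h, B_S h, C_S h, E6_S h]
    ring
  · have := ((tendsto_A.mul tendsto_B).mul tendsto_C).sub (tendsto_E6.div_const 4)
    norm_num at this
    exact this

lemma E6_eq {τ : ℂ} (h : τ ∈ UHP) : E6 τ = 4 * E2_2 τ ^ 3 - 3 * E2_2 τ * E4 τ := by
  have h1 := sum_ABC h
  have h2 := sum2_ABC h
  have h3 := prod_ABC h
  linear_combination (-4) * h3 + 4 * E2_2 τ * h2 - 4 * E2_2 τ ^ 2 * h1

lemma A_sq_ne {τ : ℂ} (h : τ ∈ UHP) : 4 * E2_2 τ ^ 2 - E4 τ ≠ 0 := by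
  intro h0
  let z : UpperHalfPlane := ⟨τ, h⟩
  have h1 := ModularForm.discriminant_ne_zero z
  rw [ModularForm.discriminant_eq_E₄_cube_sub_E₆_sq, ← E4_coe, ← E6_coe] at h1
  apply h1
  have h3 : (z : ℂ) = τ := rfl
  rw [h3, E6_eq h, show E4 τ = 4 * E2_2 τ ^ 2 by linear_combination -h0]
  ring

lemma Dop_hasDerivAt {F : ℂ → ℂ} {τ : ℂ} (hF : DifferentiableAt ℂ F τ) :
    HasDerivAt F (2 * (Real.pi : ℂ) * I * Dop F τ) τ := by
  rw [Dop, mul_inv_cancel_left₀ tpi_ne]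
  exact hF.hasDerivAt

lemma Dop_of_hasDerivAt {F : ℂ → ℂ} {τ d : ℂ} (h : HasDerivAt F (2 * (Real.pi : ℂ) * I * d) τ) :
    Dop F τ = d := by
  rw [Dop, h.deriv, inv_mul_cancel_left₀ tpi_ne]

lemma Dop_congr {F G : ℂ → ℂ} (h : ∀ τ ∈ UHP, F τ = G τ) {τ : ℂ} (hτ : τ ∈ UHP) :
    Dop F τ = Dop G τ := by
  have : F =ᶠ[𝓝 τ] G := by
    filter_upwards [isOpen_UHP.mem_nhds hτ] with x hx using h x hx
  rw [Dop, Dop, this.deriv_eq]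

lemma Dop_A {τ : ℂ} (h : τ ∈ UHP) :
    Dop E2_2 τ = (E4 τ - 2 * E2_2 τ ^ 2 + E2_2 τ * E2 τ) / 6 := by
  have hA := Dop_hasDerivAt (diffAt diff_A h)
  have h4 := Dop_hasDerivAt (diffAt diff_E4 h)
  have h1 : Dop E6 τ = 12 * E2_2 τ ^ 2 * Dop E2_2 τ
      - 3 * (Dop E2_2 τ * E4 τ + E2_2 τ * Dop E4 τ) := by
    rw [Dop_congr (G := fun τ => 4 * E2_2 τ ^ 3 - 3 * (E2_2 τ * E4 τ))
      (fun x hx => by rw [E6_eq hx]; ring) h]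
    apply Dop_of_hasDerivAt
    convert! ((hA.pow 3).const_mul 4).sub ((hA.mul h4).const_mul 3) using 1
    push_cast
    ring
  rw [ramanujan4 h, ramanujan6 h, E6_eq h] at h1
  have h2 := A_sq_ne h
  apply mul_left_cancel₀ h2
  linear_combination (-1 / 3) * h1

lemma eta_eq (τ : ℂ) : dedekindEta τ = ModularForm.eta τ := by
  simp only [dedekindEta, ModularForm.eta, ModularForm.eta_q_eq_pow, qc,
    Function.Periodic.qParam]
  norm_num

lemma eta_hasDerivAt {τ : ℂ} (h : τ ∈ UHP) :
    HasDerivAt dedekindEta (2 * (Real.pi : ℂ) * I * (E2 τ / 24 * dedekindEta τ)) τ := by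
  have h0 : ModularForm.eta τ ≠ 0 := ModularForm.eta_ne_zero h
  have h1 := ModularForm.logDeriv_eta_eq_E2 ⟨τ, h⟩
  rw [← E2_coe, logDeriv_apply] at h1
  have h2 := (ModularForm.differentiableAt_eta_of_mem_upperHalfPlaneSet h).hasDerivAt
  rw [show dedekindEta = ModularForm.eta from funext eta_eq]
  convert! h2 using 1
  have h3 : deriv ModularForm.eta τ / ModularForm.eta τ = Real.pi * I / 12 * E2 τ := h1
  rw [div_eq_iff h0] at h3
  rw [h3]
  ring

lemma eta_ne {τ : ℂ} (h : τ ∈ UHP) : dedekindEta τ ≠ 0 := by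
  rw [eta_eq]
  exact ModularForm.eta_ne_zero h

/-- The eta quotient. -/
def gq (τ : ℂ) : ℂ := dedekindEta (2 * τ) ^ 24 / dedekindEta τ ^ 28

lemma gq_hasDerivAt {τ : ℂ} (h : τ ∈ UHP) :
    HasDerivAt gq (2 * (Real.pi : ℂ) * I * ((E2_2 τ - E2 τ / 6) * gq τ)) τ := by
  have h0 := eta_ne h
  have h1 := (eta_hasDerivAt h).pow 28
  have h2 : HasDerivAt (fun x => dedekindEta (2 * x))
      (2 * (Real.pi : ℂ) * I * (E2 (2 * τ) / 24 * dedekindEta (2 * τ)) * 2) τ := by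
    refine HasDerivAt.comp τ (eta_hasDerivAt (two_mul_mem h)) ?_
    simpa using! (hasDerivAt_id τ).const_mul (2 : ℂ)
  convert! (h2.pow 24).div h1 (pow_ne_zero 28 h0) using 1
  simp only [gq, E2_2, Pi.pow_apply]
  field_simp
  ring

lemma charF4_eq : charF4 = fun τ => E2_2 τ * gq τ := by
  ext τ
  rw [charF4, gq, mul_div_assoc]

lemma charF4_hasDerivAt {τ : ℂ} (h : τ ∈ UHP) :
    HasDerivAt charF4 (2 * (Real.pi : ℂ) * I * ((E4 τ / 6 + 2 / 3 * E2_2 τ ^ 2) * gq τ)) τ := by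
  rw [charF4_eq]
  have := (Dop_hasDerivAt (diffAt diff_A h)).mul (gq_hasDerivAt h)
  rw [Dop_A h] at this
  convert! this using 1
  ring

lemma Dop_Dop_charF4 {τ : ℂ} (h : τ ∈ UHP) :
    Dop (Dop charF4) τ = ((E2 τ * E4 τ - E6 τ) / 18
      + 4 / 3 * E2_2 τ * ((E4 τ - 2 * E2_2 τ ^ 2 + E2_2 τ * E2 τ) / 6)
      + (E4 τ / 6 + 2 / 3 * E2_2 τ ^ 2) * (E2_2 τ - E2 τ / 6)) * gq τ := by
  rw [Dop_congr (fun x hx => Dop_of_hasDerivAt (charF4_hasDerivAt hx)) h]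
  apply Dop_of_hasDerivAt
  have hA := Dop_hasDerivAt (diffAt diff_A h)
  have h4 := Dop_hasDerivAt (diffAt diff_E4 h)
  rw [Dop_A h] at hA
  rw [ramanujan4 h] at h4
  convert! ((h4.div_const 6).add ((hA.pow 2).const_mul (2 / 3))).mul (gq_hasDerivAt h) using 1
  simp only [Pi.add_apply, Pi.pow_apply]
  push_cast
  ring


theorem charF4_holo_and_MLDE :
    DifferentiableOn ℂ charF4 UHP ∧
      ∀ τ ∈ UHP,
        Dop (Dop charF4) τ - (1 / 6 : ℂ) * E2 τ * Dop charF4 τ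
          - (5 / 9 : ℂ) * E4 τ * charF4 τ = 0 := by
  refine ⟨fun τ h => (charF4_hasDerivAt h).differentiableAt.differentiableWithinAt, ?_⟩
  intro τ h
  rw [Dop_Dop_charF4 h, Dop_of_hasDerivAt (charF4_hasDerivAt h), charF4_eq, E6_eq h]
  ring
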